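/- Let B be an even simple Bratteli diagram with full group G=G_B and path space X=X_B, and suppose (X,G) admits exactly k ergodic G-invariant Borel probability measures μ_1,…,μ_k (1≤k<∞). Let φ be an atomless ergodic invariant random subgroup of G and suppose there are nonnegative reals c_∞ and c_α (α∈Z_{≥0}^k) with c_∞+Σ_α c_α=1 such that φ(Fix_{Sub(G)}(g)) = c_∞·1_{g=e} + Σ_{α∈Z_{≥0}^k} c_α·μ_α(Fix_{X^{|α|}}(g)) for every g∈G, where μ_α=μ_1^{α_1}×⋯×μ_k^{α_k}. Then for every clopen set A⊊X, φ(F(A)) = Σ_{α∈Z_{≥0}^k} c_α·μ_α(A^{|α|}). -/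

import Mathlib

open MeasureTheory Filter
open scoped ENNReal ComplexOrder

noncomputable section

/-- A Bratteli diagram: vertex levels `V i`, edge levels `E i` (edges from `V i` to `V (i+1)`),
all levels finite and nonempty, a single root vertex, and source/range maps that are
surjective (every vertex emits and receives an edge). -/
structure BratteliDiagram where
  V : ℕ → Type
  E : ℕ → Type
  fintypeV : ∀ i, Fintype (V i)
  fintypeE : ∀ i, Fintype (E i)
  nonemptyV : ∀ i, Nonempty (V i)
  nonemptyE : ∀ i, Nonempty (E i)
  subsingleton_root : Subsingleton (V 0)
  src : ∀ i, E i → V i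
  rng : ∀ i, E i → V (i + 1)
  src_surj : ∀ i, Function.Surjective (src i)
  rng_surj : ∀ i, Function.Surjective (rng i)

namespace BratteliDiagram

variable (B : BratteliDiagram)

/-- The path space `X_B`: infinite paths starting at the root. -/
def Path : Type :=
  { x : ∀ i, B.E i // ∀ i, B.rng i (x i) = B.src (i + 1) (x (i + 1)) }

instance (i : ℕ) : UniformSpace (B.E i) := ⊥

instance instUniformSpacePath : UniformSpace B.Path :=
  inferInstanceAs (UniformSpace { x : ∀ i, B.E i // ∀ i, B.rng i (x i) = B.src (i + 1) (x (i + 1)) })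

instance instMeasurableSpacePath : MeasurableSpace B.Path := borel _

/-- Finite segments of `L+1` consecutive edges starting at level `n`. -/
def Seg (n L : ℕ) : Type :=
  { f : ∀ i : Fin (L + 1), B.E (n + (i : ℕ)) //
    ∀ (i : ℕ) (hi : i < L),
      B.rng (n + i) (f ⟨i, by omega⟩) = B.src (n + (i + 1)) (f ⟨i + 1, by omega⟩) }

/-- The number of finite paths connecting `v ∈ V n` to `w ∈ V (n + L + 1)`. -/
def numPaths (n L : ℕ) (v : B.V n) (w : B.V (n + L + 1)) : ℕ :=
  Nat.card { f : B.Seg n L //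
    B.src n (f.1 ⟨0, by omega⟩) = v ∧ B.rng (n + L) (f.1 ⟨L, by omega⟩) = w }

/-- A Bratteli diagram is simple if every vertex of a given level is connected
to every vertex of some deeper level. -/
def IsSimple : Prop :=
  ∀ n : ℕ, ∃ L : ℕ, ∀ (v : B.V n) (w : B.V (n + L + 1)), 0 < B.numPaths n L v w

/-- A Bratteli diagram is even if every vertex of a given level is connected to every
vertex of some deeper level by a (positive) even number of paths. -/
def IsEven : Prop :=
  ∀ n : ℕ, ∃ L : ℕ, ∀ (v : B.V n) (w : B.V (n + L + 1)),
    0 < B.numPaths n L v w ∧ Even (B.numPaths n L v w)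

/-- A permutation of the path space "of level `n`": it changes only the first `n` edges,
and what it does to the first `n` edges depends only on the first `n` edges. -/
def IsLevel (n : ℕ) (g : Equiv.Perm B.Path) : Prop :=
  (∀ (x : B.Path) (i : ℕ), n ≤ i → (g x).1 i = x.1 i) ∧
  (∀ x y : B.Path, (∀ i : ℕ, i < n → x.1 i = y.1 i) → ∀ i : ℕ, i < n → (g x).1 i = (g y).1 i)

theorem isLevel_one (n : ℕ) : B.IsLevel n 1 :=
  ⟨fun _ _ _ => rfl, fun _ _ h i hi => h i hi⟩

theorem IsLevel.mul {n : ℕ} {a b : Equiv.Perm B.Path} (ha : B.IsLevel n a)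
    (hb : B.IsLevel n b) : B.IsLevel n (a * b) := by
  constructor
  · intro x i hi
    have h1 := ha.1 (b x) i hi
    have h2 := hb.1 x i hi
    simpa [Equiv.Perm.mul_apply] using h1.trans h2
  · intro x y hxy i hi
    have h2 := hb.2 x y hxy
    have := ha.2 (b x) (b y) h2 i hi
    simpa [Equiv.Perm.mul_apply] using this

theorem IsLevel.mono {n m : ℕ} (hnm : n ≤ m) {g : Equiv.Perm B.Path}
    (h : B.IsLevel n g) : B.IsLevel m g := by
  refine ⟨fun x i hi => h.1 x i (hnm.trans hi), fun x y hxy i hi => ?_⟩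
  rcases lt_or_ge i n with h' | h'
  · exact h.2 x y (fun j hj => hxy j (hj.trans_le hnm)) i h'
  · rw [h.1 x i h', h.1 y i h']
    exact hxy i hi

/-- The group `G_n` of homeomorphisms of the path space permuting only the
first `n` edges of infinite paths. -/
def level (n : ℕ) : Subgroup (Equiv.Perm B.Path) where
  carrier := { g | B.IsLevel n g ∧ B.IsLevel n g⁻¹ }
  one_mem' := ⟨B.isLevel_one n, by simpa using B.isLevel_one n⟩
  mul_mem' := by
    intro a b ha hb
    exact ⟨ha.1.mul B hb.1, by rw [mul_inv_rev]; exact IsLevel.mul B hb.2 ha.2⟩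
  inv_mem' := by
    intro a ha
    exact ⟨ha.2, by simpa using ha.1⟩

theorem level_mono {n m : ℕ} (h : n ≤ m) : B.level n ≤ B.level m := by
  intro g hg
  exact ⟨hg.1.mono B h, hg.2.mono B h⟩

/-- The full group `G_B = ⋃ n, G_n` of the Bratteli diagram. -/
def fullGroup : Subgroup (Equiv.Perm B.Path) where
  carrier := { g | ∃ n, g ∈ B.level n }
  one_mem' := ⟨0, one_mem _⟩
  mul_mem' := by
    rintro a b ⟨n, ha⟩ ⟨m, hb⟩
    exact ⟨max n m, mul_mem (B.level_mono (le_max_left n m) ha)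
      (B.level_mono (le_max_right n m) hb)⟩
  inv_mem' := by
    rintro a ⟨n, ha⟩
    exact ⟨n, inv_mem ha⟩

/-- `G_n` viewed as a subgroup of the full group. -/
def levelIn (n : ℕ) : Subgroup ↥B.fullGroup := (B.level n).comap B.fullGroup.subtype

/-- The subgroup `G°(A)` of elements of the full group fixing `A` pointwise. -/
def Gcirc (A : Set B.Path) : Subgroup ↥B.fullGroup :=
  ⨅ x ∈ A, MulAction.stabilizer ↥B.fullGroup x

/-- `G°_n(A) = G_n ∩ G°(A)`. -/
def GcircN (n : ℕ) (A : Set B.Path) : Subgroup ↥B.fullGroup :=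
  B.levelIn n ⊓ B.Gcirc A

end BratteliDiagram

/-- Conjugation of a subgroup: `g • H = gHg⁻¹`. -/
def conjSub {Γ : Type*} [Group Γ] (g : Γ) (H : Subgroup Γ) : Subgroup Γ :=
  Subgroup.map (MulAut.conj g).toMonoidHom H

/-- The Borel structure on the space `Sub(Γ)` of subgroups of `Γ`,
induced from the product space `{0,1}^Γ` (equivalently `Set Γ`). -/
instance subgroupMeasurableSpace {Γ : Type*} [Group Γ] : MeasurableSpace (Subgroup Γ) :=
  MeasurableSpace.comap (fun H => (H : Set Γ)) inferInstance

namespace BratteliDiagram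

variable (B : BratteliDiagram)

/-- `F(A)`: the collection of subgroups of the full group normalized by `G°(A)`. -/
def FF (A : Set B.Path) : Set (Subgroup ↥B.fullGroup) :=
  { H | ∀ g ∈ B.Gcirc A, conjSub g H = H }

end BratteliDiagram

/-- A measure `ν` on `Y` is invariant under the action of `G`. -/
def MeasInv (G : Type*) [Group G] {Y : Type*} [MeasurableSpace Y] [MulAction G Y]
    (ν : Measure Y) : Prop :=
  ∀ (g : G) (s : Set Y), MeasurableSet s → ν ((fun y => g • y) ⁻¹' s) = ν s

/-- The action of `G` on `(Y, ν)` is ergodic: every invariant measurable set is null or conull. -/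
def MeasErg (G : Type*) [Group G] {Y : Type*} [MeasurableSpace Y] [MulAction G Y]
    (ν : Measure Y) : Prop :=
  ∀ s : Set Y, MeasurableSet s → (∀ g : G, (fun y => g • y) ⁻¹' s = s) → ν s = 0 ∨ ν s = 1

/-- An invariant random subgroup: a conjugation-invariant Borel probability measure on `Sub(G)`. -/
def IsIRS (G : Type*) [Group G] (φ : Measure (Subgroup G)) : Prop :=
  IsProbabilityMeasure φ ∧
    ∀ (g : G) (s : Set (Subgroup G)), MeasurableSet s → φ (conjSub g ⁻¹' s) = φ s

/-- An ergodic invariant random subgroup. -/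
def IsErgodicIRS (G : Type*) [Group G] (φ : Measure (Subgroup G)) : Prop :=
  IsIRS G φ ∧
    ∀ s : Set (Subgroup G), MeasurableSet s → (∀ g : G, conjSub g ⁻¹' s = s) →
      φ s = 0 ∨ φ s = 1

/-- A character of a group: normalized, central, positive semidefinite complex function. -/
def IsCharacter (G : Type*) [Group G] (χ : G → ℂ) : Prop :=
  χ 1 = 1 ∧ (∀ a b : G, χ (a * b) = χ (b * a)) ∧
    ∀ (n : ℕ) (g : Fin n → G) (c : Fin n → ℂ),
      0 ≤ ∑ i, ∑ j, (starRingEnd ℂ) (c i) * c j * χ (g i * (g j)⁻¹)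

namespace BratteliDiagram

variable (B : BratteliDiagram)

/-- The product measure `μ_α = μ_1^{α_1} × ⋯ × μ_k^{α_k}` on `X^{|α|}`,
realized on the index type `Σ i : Fin k, Fin (α i)` (of cardinality `|α| = Σ α i`). -/
def prodMeasure {k : ℕ} (μ : Fin k → Measure B.Path) (α : Fin k → ℕ) :
    Measure ((Σ i : Fin k, Fin (α i)) → B.Path) :=
  Measure.pi fun p => μ p.1

/-- The stabilizer distribution `φ_α` of the diagonal action of the full group
on `(X^{|α|}, μ_α)`. -/
def stabDist {k : ℕ} (μ : Fin k → Measure B.Path) (α : Fin k → ℕ) :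
    Measure (Subgroup ↥B.fullGroup) :=
  Measure.map (fun y => MulAction.stabilizer ↥B.fullGroup y) (B.prodMeasure μ α)

end BratteliDiagram


namespace BratteliDiagram

variable (B : BratteliDiagram)

theorem exists_forward (n : ℕ) (e : B.E n) :
    ∃ F : ∀ i : ℕ, B.E (n + i), F 0 = e ∧
      ∀ i, B.rng (n + i) (F i) = B.src (n + (i + 1)) (F (i + 1)) := by
  choose nx hnx using fun i => B.src_surj i
  refine ⟨fun i => Nat.rec (motive := fun i => B.E (n + i)) e
    (fun i x => nx (n + (i + 1)) (B.rng (n + i) x)) i, rfl, fun i => ?_⟩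
  exact (hnx _ _).symm

theorem exists_glue (n : ℕ) (x : B.Path) (F : ∀ i : ℕ, B.E (n + i))
    (hF : ∀ i, B.rng (n + i) (F i) = B.src (n + (i + 1)) (F (i + 1)))
    (h : B.src n (x.1 n) = B.src n (F 0)) :
    ∃ y : B.Path, (∀ j, j < n → y.1 j = x.1 j) ∧ ∀ i, y.1 (n + i) = F i := by
  let f : ∀ j, B.E j := fun j =>
    if hj : n ≤ j then cast (congrArg B.E (Nat.add_sub_of_le hj)) (F (j - n)) else x.1 j
  have h1 : ∀ j, j < n → f j = x.1 j := fun j hj => by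
    simp only [f]; rw [dif_neg (by omega)]
  have h2 : ∀ i, f (n + i) = F i := fun i => by
    simp only [f]; rw [dif_pos (by omega)]
    have : ∀ k (_ : k = i) (e : B.E (n + k) = B.E (n + i)), cast e (F k) = F i := by
      rintro k rfl e; rfl
    exact this _ (by omega) _
  refine ⟨⟨f, fun j => ?_⟩, h1, h2⟩
  rcases lt_trichotomy (j + 1) n with hj | hj | hj
  · rw [h1 _ hj, h1 _ (by omega)]; exact x.2 j
  · subst hj
    rw [h1 j (by omega), x.2 j, h]
    exact congrArg _ (h2 0).symm
  · obtain ⟨i, rfl⟩ : ∃ i, j = n + i := ⟨j - n, by omega⟩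
    rw [h2 i]
    have := h2 (i + 1)
    rw [hF]
    exact congrArg _ this.symm

theorem exists_path_through (n : ℕ) (v : B.V n) : ∃ x : B.Path, B.src n (x.1 n) = v := by
  induction n with
  | zero =>
    obtain ⟨e, he⟩ := B.src_surj 0 v
    obtain ⟨F, hF0, hF⟩ := B.exists_forward 0 e
    have key : ∀ j, 0 + j = j := fun j => by omega
    obtain ⟨g, hg⟩ : ∃ g : ∀ j, B.E j, ∀ j, HEq (g j) (F j) :=
      ⟨fun j => cast (congrArg B.E (key j)) (F j), fun j => cast_heq _ _⟩
    refine ⟨⟨g, fun i => ?_⟩, B.subsingleton_root.elim _ _⟩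
    have h := hF i
    have e1 : ∀ (a b : ℕ) (_ : a = b) (c d : ℕ) (_ : c = d) (hc : c = a + 1) (hd : d = b + 1)
        (p : B.E a) (q : B.E b) (_ : HEq p q) (r : B.E c) (s : B.E d) (_ : HEq r s),
        B.rng a p = hc ▸ B.src c r → B.rng b q = hd ▸ B.src d s := by
      rintro a b rfl c d rfl hc hd p q hpq r s hrs h
      obtain rfl := eq_of_heq hpq
      obtain rfl := eq_of_heq hrs
      exact h
    exact e1 (0 + i) i (key i) (0 + (i + 1)) (i + 1) (key _) rfl rfl _ _ (hg i).symm _ _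
      (hg (i+1)).symm h
  | succ n ih =>
    obtain ⟨e, he⟩ := B.rng_surj n v
    obtain ⟨x, hx⟩ := ih (B.src n e)
    obtain ⟨F, hF0, hF⟩ := B.exists_forward n e
    obtain ⟨y, -, hy⟩ := B.exists_glue n x F hF (by rw [hF0, hx])
    refine ⟨y, ?_⟩
    rw [← y.2 n, ← he, ← hF0]
    exact congrArg _ (hy 0)

theorem Path.ext' {x y : B.Path} (h : ∀ i, x.1 i = y.1 i) : x = y :=
  Subtype.ext (funext h)

/-- First `m` edges of `x`, then `y`. -/
theorem exists_splice (m : ℕ) (x y : B.Path) (h : B.src m (x.1 m) = B.src m (y.1 m)) :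
    ∃ z : B.Path, (∀ j, j < m → z.1 j = x.1 j) ∧ ∀ j, m ≤ j → z.1 j = y.1 j := by
  obtain ⟨z, h1, h2⟩ := B.exists_glue m x (fun i => y.1 (m + i)) (fun i => y.2 (m + i)) h
  refine ⟨z, h1, fun j hj => ?_⟩
  obtain ⟨i, rfl⟩ := Nat.exists_eq_add_of_le hj
  exact h2 i

def splice (m : ℕ) (x y : B.Path) (h : B.src m (x.1 m) = B.src m (y.1 m)) : B.Path :=
  (B.exists_splice m x y h).choose

theorem splice_lt {m : ℕ} {x y : B.Path} (h) {j : ℕ} (hj : j < m) :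
    (B.splice m x y h).1 j = x.1 j := (B.exists_splice m x y h).choose_spec.1 j hj

theorem splice_ge {m : ℕ} {x y : B.Path} (h) {j : ℕ} (hj : m ≤ j) :
    (B.splice m x y h).1 j = y.1 j := (B.exists_splice m x y h).choose_spec.2 j hj

theorem endpoint_eq {m : ℕ} {x y : B.Path} (h : ∀ j, j < m → x.1 j = y.1 j) :
    B.src m (x.1 m) = B.src m (y.1 m) := by
  cases m with
  | zero => exact B.subsingleton_root.elim _ _
  | succ n => rw [← x.2 n, ← y.2 n, h n (by omega)]

theorem path_eq_of {m : ℕ} {x y : B.Path} (h : ∀ j, j < m → x.1 j = y.1 j)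
    (h' : ∀ j, m ≤ j → x.1 j = y.1 j) : x = y :=
  Path.ext' B fun j => (lt_or_ge j m).elim (h j) (h' j)

/-- `A` depends only on the first `m` edges. -/
def IsDet (m : ℕ) (A : Set B.Path) : Prop :=
  ∀ x y : B.Path, (∀ j, j < m → x.1 j = y.1 j) → (x ∈ A ↔ y ∈ A)

theorem IsDet.mono {m n : ℕ} (h : m ≤ n) {A : Set B.Path} (hA : B.IsDet m A) : B.IsDet n A :=
  fun x y hxy => hA x y fun j hj => hxy j (by omega)

/-- Paths off `A` with the same tail as `t`. -/
def PSet (A : Set B.Path) (m : ℕ) (t : B.Path) (x : B.Path) : Prop :=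
  x ∉ A ∧ ∀ j, m ≤ j → x.1 j = t.1 j

abbrev PT (A : Set B.Path) (m : ℕ) (t : B.Path) : Type := {x : B.Path // B.PSet A m t x}

instance finiteE (i : ℕ) : Finite (B.E i) := @Finite.of_fintype _ (B.fintypeE i)
instance finiteV (i : ℕ) : Finite (B.V i) := @Finite.of_fintype _ (B.fintypeV i)

instance finitePT (A : Set B.Path) (m : ℕ) (t : B.Path) : Finite (B.PT A m t) := by
  refine Finite.of_injective (β := ∀ i : Fin m, B.E i) (fun x i => x.1.1 i) fun x y h => ?_
  refine Subtype.ext (B.path_eq_of (m := m) (fun j hj => congrFun h ⟨j, hj⟩) fun j hj => ?_)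
  rw [x.2.2 j hj, y.2.2 j hj]

instance finiteSeg (n L : ℕ) : Finite (B.Seg n L) := Subtype.finite

theorem finite_level (n : ℕ) : Finite (B.level n) := by
  let π : B.Path → (∀ i : Fin n, B.E i) := fun x i => x.1 i
  refine Finite.of_injective
    (β := Set ((∀ i : Fin n, B.E i) × (∀ i : Fin n, B.E i)))
    (fun g => Set.range fun x => (π x, π (g.1 x))) fun g h hgh => ?_
  ext1; ext1 x
  have hm : (π x, π (g.1 x)) ∈ Set.range fun x => (π x, π (h.1 x)) := by
    simp only at hgh; rw [← hgh]; exact ⟨x, rfl⟩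
  obtain ⟨y, hy⟩ := hm
  simp only [Prod.mk.injEq] at hy
  refine B.path_eq_of (m := n) (fun j hj => ?_) fun j hj => ?_
  · have h1 := congrFun hy.2 ⟨j, hj⟩
    have h2 := h.2.1.2 y x (fun i hi => congrFun hy.1 ⟨i, hi⟩) j hj
    exact h1.symm.trans h2
  · rw [g.2.1.1 x j hj, h.2.1.1 x j hj]

theorem finite_levelIn (n : ℕ) : Finite (B.levelIn n) := by
  have := B.finite_level n
  exact Finite.of_injective (fun g : B.levelIn n => (⟨g.1.1, g.2⟩ : B.level n))
    fun g h hgh => Subtype.ext (Subtype.ext (congrArg (fun z : B.level n => z.1) hgh))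

instance finite_GcircN (n : ℕ) (A : Set B.Path) : Finite (B.GcircN n A) := by
  have := B.finite_levelIn n
  exact Finite.of_injective (fun g : B.GcircN n A => (⟨g.1, g.2.1⟩ : B.levelIn n))
    fun g h hgh => Subtype.ext (congrArg (fun z : B.levelIn n => z.1) hgh)

theorem mem_levelIn_exists (g : ↥B.fullGroup) : ∃ n, g ∈ B.levelIn n := g.2

instance countable_fullGroup : Countable ↥B.fullGroup := by
  have : (Set.univ : Set ↥B.fullGroup) = ⋃ n, (B.levelIn n : Set ↥B.fullGroup) := by
    ext g; simpa using B.mem_levelIn_exists g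
  rw [← Set.countable_univ_iff, this]
  refine Set.countable_iUnion fun n => ?_
  have := B.finite_levelIn n
  exact (Set.toFinite _).countable

theorem GcircN_mono (A : Set B.Path) : Monotone fun n => B.GcircN n A := fun _ _ h _ hg =>
  ⟨B.level_mono h hg.1, hg.2⟩

theorem mem_Gcirc {A : Set B.Path} {g : ↥B.fullGroup} :
    g ∈ B.Gcirc A ↔ ∀ x ∈ A, g.1 x = x := by
  simp [Gcirc, Subgroup.mem_iInf, MulAction.mem_stabilizer_iff, Subgroup.smul_def]

instance : BorelSpace B.Path := ⟨rfl⟩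

theorem IsDet.isOpen {m : ℕ} {A : Set B.Path} (hA : B.IsDet m A) : IsOpen A := by
  rw [isOpen_iff_mem_nhds]
  intro x hx
  have h : ∀ j, {y : B.Path | y.1 j = x.1 j} ∈ nhds x := fun j => by
    have hc : Continuous fun y : B.Path => y.1 j :=
      (continuous_apply j).comp continuous_subtype_val
    have : DiscreteTopology (B.E j) := ⟨rfl⟩
    exact hc.continuousAt (IsOpen.mem_nhds (isOpen_discrete {x.1 j}) rfl)
  have h2 : (⋂ j ∈ Set.Iio m, {y : B.Path | y.1 j = x.1 j}) ∈ nhds x :=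
    (Filter.biInter_mem (Set.finite_Iio m)).2 fun j _ => h j
  refine Filter.mem_of_superset h2 fun y hy => ?_
  simp only [Set.mem_iInter] at hy
  exact (hA y x fun j hj => hy j hj).2 hx

instance compactPath : CompactSpace B.Path := by
  have : ∀ j, DiscreteTopology (B.E j) := fun j => ⟨rfl⟩
  have hcl : IsClosed {x : ∀ i, B.E i | ∀ i, B.rng i (x i) = B.src (i + 1) (x (i + 1))} := by
    simp only [Set.ofPred_forall]
    refine isClosed_iInter fun i => ?_
    have : Continuous fun x : ∀ i, B.E i => (x i, x (i+1)) := by fun_prop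
    exact (isClosed_discrete {p : B.E i × B.E (i+1) | B.rng i p.1 = B.src (i + 1) p.2}).preimage this
  exact isCompact_iff_compactSpace.1 hcl.isCompact

theorem exists_isDet {A : Set B.Path} (hA : IsClopen A) : ∃ m, B.IsDet m A := by
  have : ∀ j, DiscreteTopology (B.E j) := fun j => ⟨rfl⟩
  have key : ∀ x : B.Path, ∃ m, ∀ y : B.Path, (∀ j, j < m → y.1 j = x.1 j) →
      (y ∈ A ↔ x ∈ A) := by
    intro x
    have h1 : {y : B.Path | y ∈ A ↔ x ∈ A} ∈ nhds x := by
      by_cases hx : x ∈ A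
      · exact Filter.mem_of_superset (hA.isOpen.mem_nhds hx) fun y hy => by simp_all
      · exact Filter.mem_of_superset (hA.compl.isOpen.mem_nhds hx) fun y hy => by simp_all
    obtain ⟨u, hu, hus⟩ := (mem_nhds_induced (Subtype.val : B.Path → ∀ i, B.E i) x _).1 h1
    rw [mem_nhds_iff] at hu
    obtain ⟨v, hvu, hv, hxv⟩ := hu
    obtain ⟨I, w, hw, hwv⟩ := isOpen_pi_iff.1 hv _ hxv
    refine ⟨I.sup id + 1, fun y hy => hus (hvu (hwv ?_))⟩
    intro j hj
    rw [hy j (Nat.lt_succ_of_le (Finset.le_sup (f := id) hj))]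
    exact (hw j hj).2
  choose m hm using key
  have hopen : ∀ x : B.Path, {y : B.Path | ∀ j, j < m x → y.1 j = x.1 j} ∈ nhds x := fun x => by
    refine IsOpen.mem_nhds (IsDet.isOpen B (m := m x) ?_) fun j _ => rfl
    intro a b hab
    exact forall₂_congr fun j hj => by rw [hab j hj]
  obtain ⟨s, hs⟩ := CompactSpace.elim_nhds_subcover _ hopen
  refine ⟨s.sup m, fun x y hxy => ?_⟩
  have hx : x ∈ (⊤ : Set B.Path) := trivial
  rw [← hs] at hx
  simp only [Set.mem_iUnion] at hx
  obtain ⟨z, hz, hxz⟩ := hx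
  have hle : m z ≤ s.sup m := Finset.le_sup hz
  rw [hm z x hxz, hm z y fun j hj => by rw [← hxy j (by omega)]; exact hxz j hj]

end BratteliDiagram

namespace BratteliDiagram

variable (B : BratteliDiagram)

section Theta

variable {A : Set B.Path} {m : ℕ} (hA : B.IsDet m A) (t : B.V m → B.Path)
  (ht : ∀ w, B.src m ((t w).1 m) = w)

theorem baseAux {A : Set B.Path} {m : ℕ} (hA : B.IsDet m A) {t : B.V m → B.Path} (ht : ∀ w, B.src m ((t w).1 m) = w)
    (x : B.Path) (hx : x ∉ A) (w : B.V m) (hw : B.src m (x.1 m) = w) :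
    B.PSet A m (t w) (B.splice m x (t w) (hw.trans (ht w).symm)) :=
  ⟨fun h => hx ((hA _ _ fun _ hj => B.splice_lt _ hj).1 h), fun _ hj => B.splice_ge _ hj⟩

def base (x : B.Path) (hx : x ∉ A) (w : B.V m) (hw : B.src m (x.1 m) = w) : B.PT A m (t w) :=
  ⟨B.splice m x (t w) (hw.trans (ht w).symm), B.baseAux hA ht x hx w hw⟩

theorem base_lt (x : B.Path) (hx : x ∉ A) (w : B.V m) (hw : B.src m (x.1 m) = w) {j : ℕ}
    (hj : j < m) : (B.base hA t ht x hx w hw).1.1 j = x.1 j :=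
  B.splice_lt (hw.trans (ht w).symm) hj

theorem actAux {t : B.V m → B.Path} (ht : ∀ w, B.src m ((t w).1 m) = w) (x : B.Path)
    (w : B.V m) (hw : B.src m (x.1 m) = w) (z : B.PT A m (t w)) :
    B.src m (z.1.1 m) = B.src m (x.1 m) := by
  rw [z.2.2 m le_rfl, ht, hw]

open Classical in
def thetaFun (σ : ∀ w, Equiv.Perm (B.PT A m (t w))) (x : B.Path) : B.Path :=
  if hx : x ∉ A then
    B.splice m (σ _ (B.base hA t ht x hx _ rfl)).1 x (B.actAux ht x _ rfl _)
  else x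

theorem thetaFun_mem (σ : ∀ w, Equiv.Perm (B.PT A m (t w))) {x : B.Path} (hx : x ∈ A) :
    B.thetaFun hA t ht σ x = x := dif_neg (by simpa using hx)

theorem thetaFun_notMem (σ : ∀ w, Equiv.Perm (B.PT A m (t w))) {x : B.Path} (hx : x ∉ A)
    (w : B.V m) (hw : B.src m (x.1 m) = w) :
    B.thetaFun hA t ht σ x =
      B.splice m (σ w (B.base hA t ht x hx w hw)).1 x (B.actAux ht x w hw _) := by
  subst hw
  exact dif_pos hx

theorem thetaFun_ge (σ : ∀ w, Equiv.Perm (B.PT A m (t w))) (x : B.Path) {j : ℕ} (hj : m ≤ j) :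
    (B.thetaFun hA t ht σ x).1 j = x.1 j := by
  by_cases hx : x ∈ A
  · rw [thetaFun_mem B hA t ht σ hx]
  · rw [thetaFun_notMem B hA t ht σ hx _ rfl, splice_ge B _ hj]

theorem thetaFun_notMem_A (σ : ∀ w, Equiv.Perm (B.PT A m (t w))) {x : B.Path} (hx : x ∉ A) :
    B.thetaFun hA t ht σ x ∉ A := by
  rw [thetaFun_notMem B hA t ht σ hx _ rfl]
  intro h
  rw [hA _ _ fun _ hj => B.splice_lt _ hj] at h
  exact (σ _ (B.base hA t ht x hx _ rfl)).2.1 h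

theorem base_thetaFun (σ : ∀ w, Equiv.Perm (B.PT A m (t w))) {x : B.Path} (hx : x ∉ A)
    (w : B.V m) (hw : B.src m (x.1 m) = w) (hx') (hw') :
    B.base hA t ht (B.thetaFun hA t ht σ x) hx' w hw' = σ w (B.base hA t ht x hx w hw) := by
  refine Subtype.ext (B.path_eq_of (m := m) (fun j hj => ?_) fun j hj => ?_)
  · simp only [base]
    rw [splice_lt B _ hj, thetaFun_notMem B hA t ht σ hx w hw, splice_lt B _ hj]
    rfl
  · rw [(σ w _).2.2 j hj]
    simp only [base]
    rw [splice_ge B _ hj]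

theorem thetaFun_mul (σ τ : ∀ w, Equiv.Perm (B.PT A m (t w))) (x : B.Path) :
    B.thetaFun hA t ht (σ * τ) x = B.thetaFun hA t ht σ (B.thetaFun hA t ht τ x) := by
  by_cases hx : x ∈ A
  · rw [thetaFun_mem B hA t ht _ hx, thetaFun_mem B hA t ht _ hx, thetaFun_mem B hA t ht _ hx]
  · have hx' := thetaFun_notMem_A B hA t ht τ hx
    have hw' : B.src m ((B.thetaFun hA t ht τ x).1 m) = B.src m (x.1 m) := by
      rw [thetaFun_ge B hA t ht τ x le_rfl]
    refine B.path_eq_of (m := m) (fun j hj => ?_) fun j hj => ?_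
    · rw [thetaFun_notMem B hA t ht _ hx _ rfl, thetaFun_notMem B hA t ht _ hx' _ hw',
        splice_lt B _ hj, splice_lt B _ hj, base_thetaFun B hA t ht τ hx _ rfl]
      rfl
    · simp only [thetaFun_ge B hA t ht _ _ hj]

theorem thetaFun_one (x : B.Path) : B.thetaFun hA t ht 1 x = x := by
  by_cases hx : x ∈ A
  · rw [thetaFun_mem B hA t ht _ hx]
  · refine B.path_eq_of (m := m) (fun j hj => ?_) fun j hj => ?_
    · rw [thetaFun_notMem B hA t ht _ hx _ rfl, splice_lt B _ hj]
      exact base_lt B hA t ht x hx _ rfl hj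
    · rw [thetaFun_ge B hA t ht _ _ hj]

theorem thetaFun_isLevel (σ : ∀ w, Equiv.Perm (B.PT A m (t w))) (x y : B.Path)
    (h : ∀ i, i < m → x.1 i = y.1 i) (i : ℕ) (hi : i < m) :
    (B.thetaFun hA t ht σ x).1 i = (B.thetaFun hA t ht σ y).1 i := by
  by_cases hx : x ∈ A
  · rw [thetaFun_mem B hA t ht _ hx, thetaFun_mem B hA t ht _ ((hA x y h).1 hx), h i hi]
  · have hy : y ∉ A := fun hy => hx ((hA x y h).2 hy)
    rw [thetaFun_notMem B hA t ht _ hx _ rfl,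
      thetaFun_notMem B hA t ht _ hy _ (B.endpoint_eq h).symm, splice_lt B _ hi, splice_lt B _ hi]
    suffices hb : B.base hA t ht x hx _ rfl = B.base hA t ht y hy _ (B.endpoint_eq h).symm by
      rw [hb]
    refine Subtype.ext (B.path_eq_of (m := m) (fun j hj => ?_) fun j hj => ?_)
    · simp only [base]
      rw [splice_lt B _ hj, splice_lt B _ hj, h j hj]
    · simp only [base]
      rw [splice_ge B _ hj, splice_ge B _ hj]

def thetaPerm (σ : ∀ w, Equiv.Perm (B.PT A m (t w))) : Equiv.Perm B.Path where
  toFun := B.thetaFun hA t ht σ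
  invFun := B.thetaFun hA t ht σ⁻¹
  left_inv x := by rw [← thetaFun_mul, inv_mul_cancel, thetaFun_one]
  right_inv x := by rw [← thetaFun_mul, mul_inv_cancel, thetaFun_one]

theorem thetaPerm_level (σ : ∀ w, Equiv.Perm (B.PT A m (t w))) :
    B.thetaPerm hA t ht σ ∈ B.level m :=
  ⟨⟨fun x _ hi => B.thetaFun_ge hA t ht σ x hi, B.thetaFun_isLevel hA t ht σ⟩,
    ⟨fun x _ hi => B.thetaFun_ge hA t ht σ⁻¹ x hi, B.thetaFun_isLevel hA t ht σ⁻¹⟩⟩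

def theta : (∀ w, Equiv.Perm (B.PT A m (t w))) →* ↥(B.Gcirc A) :=
  MonoidHom.mk' (fun σ => ⟨⟨B.thetaPerm hA t ht σ, m, B.thetaPerm_level hA t ht σ⟩,
    B.mem_Gcirc.2 fun _ hx => B.thetaFun_mem hA t ht σ hx⟩)
    fun σ τ => Subtype.ext (Subtype.ext (Equiv.ext fun x => B.thetaFun_mul hA t ht σ τ x))

end Theta

theorem PSet_iff {A : Set B.Path} {m : ℕ} (t : B.Path) {g : ↥B.fullGroup} (hg : g ∈ B.GcircN m A)
    (x : B.Path) : B.PSet A m t (g.1 x) ↔ B.PSet A m t x := by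
  have h1 : g.1 x ∈ A ↔ x ∈ A := by
    have hfix := B.mem_Gcirc.1 hg.2
    constructor
    · intro h
      have := hfix _ h
      rwa [g.1.injective this] at h
    · intro h; rwa [hfix _ h]
  have h2 : ∀ j, m ≤ j → (g.1 x).1 j = x.1 j := hg.1.1.1 x
  unfold PSet
  rw [h1]
  exact and_congr_right fun _ => forall₂_congr fun j hj => by rw [h2 j hj]

def restr {A : Set B.Path} {m : ℕ} (t : B.Path) {g : ↥B.fullGroup} (hg : g ∈ B.GcircN m A) :
    Equiv.Perm (B.PT A m t) := g.1.subtypePerm (B.PSet_iff t hg)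

theorem theta_restr {A : Set B.Path} {m : ℕ} (hA : B.IsDet m A) (t : B.V m → B.Path)
    (ht : ∀ w, B.src m ((t w).1 m) = w) {g : ↥B.fullGroup} (hg : g ∈ B.GcircN m A) :
    (B.theta hA t ht (fun w => B.restr (t w) hg)).1 = g := by
  refine Subtype.ext (Equiv.ext fun x => ?_)
  change B.thetaFun hA t ht (fun w => B.restr (t w) hg) x = g.1 x
  by_cases hx : x ∈ A
  · rw [thetaFun_mem B hA t ht _ hx, B.mem_Gcirc.1 hg.2 x hx]
  · refine B.path_eq_of (m := m) (fun j hj => ?_) fun j hj => ?_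
    · rw [thetaFun_notMem B hA t ht _ hx _ rfl, splice_lt B _ hj]
      exact hg.1.1.2 _ x (fun i hi => base_lt B hA t ht x hx _ rfl hi) j hj
    · rw [thetaFun_ge B hA t ht _ _ hj]
      exact (hg.1.1.1 x j hj).symm

/-- same endpoint: the sets `PT` are equivalent. -/
theorem PT_equiv {A : Set B.Path} {n : ℕ} (hA : B.IsDet n A) (t t' : B.Path)
    (h : B.src n (t.1 n) = B.src n (t'.1 n)) :
    ∃ e : B.PT A n t ≃ B.PT A n t', ∀ x, ∀ j, j < n → (e x).1.1 j = x.1.1 j := by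
  have hs : ∀ (t t' : B.Path) (h : B.src n (t.1 n) = B.src n (t'.1 n)) (x : B.PT A n t),
      B.src n (x.1.1 n) = B.src n (t'.1 n) := fun t t' h x => by rw [x.2.2 n le_rfl, h]
  let f : ∀ (t t' : B.Path) (h : B.src n (t.1 n) = B.src n (t'.1 n)), B.PT A n t → B.PT A n t' :=
    fun t t' h x => ⟨B.splice n x.1 t' (hs t t' h x),
      fun hh => x.2.1 ((hA _ _ fun _ hj => B.splice_lt _ hj).1 hh), fun _ hj => B.splice_ge _ hj⟩
  have hf : ∀ t t' h x, f t' t h.symm (f t t' h x) = x := by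
    intro t t' h x
    refine Subtype.ext (B.path_eq_of (m := n) (fun j hj => ?_) fun j hj => ?_)
    · exact (splice_lt B (hs t' t h.symm (f t t' h x)) hj).trans (splice_lt B (hs t t' h x) hj)
    · exact (splice_ge B (hs t' t h.symm (f t t' h x)) hj).trans (x.2.2 j hj).symm
  exact ⟨⟨f t t' h, f t' t h.symm, hf t t' h, hf t' t h.symm⟩, fun x j hj => splice_lt B (hs t t' h x) hj⟩

open Classical in
/-- sign of the restriction. -/
def sgn {A : Set B.Path} {m : ℕ} (t : B.Path) {g : ↥B.fullGroup} (hg : g ∈ B.GcircN m A) : ℤˣ :=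
  letI := Fintype.ofFinite (B.PT A m t)
  Equiv.Perm.sign (B.restr t hg)

theorem sgn_congr {A : Set B.Path} {n : ℕ} (hA : B.IsDet n A) (t t' : B.Path)
    (h : B.src n (t.1 n) = B.src n (t'.1 n)) {g : ↥B.fullGroup} (hg : g ∈ B.GcircN n A) :
    B.sgn t hg = B.sgn t' hg := by
  classical
  obtain ⟨e, he⟩ := B.PT_equiv hA t t' h
  unfold sgn
  let _ := Fintype.ofFinite (B.PT A n t)
  let _ := Fintype.ofFinite (B.PT A n t')
  refine Equiv.Perm.sign_eq_sign_of_equiv _ _ e fun x => ?_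
  refine Subtype.ext (B.path_eq_of (m := n) (fun j hj => ?_) fun j hj => ?_)
  · rw [he _ j hj]
    exact hg.1.1.2 _ _ (fun i hi => (he x i hi).symm) j hj
  · rw [(e _).2.2 j hj, (B.restr t' hg _).2.2 j hj]

end BratteliDiagram

theorem sign_fiber {P F : Type*} [DecidableEq P] [Fintype P] [DecidableEq F] [Fintype F]
    (s : P → F) (σ : Equiv.Perm P) (hσ : ∀ x, s (σ x) = s x) :
    Equiv.Perm.sign σ = ∏ f : F, Equiv.Perm.sign
      (σ.subtypePerm (p := fun x => s x = f) fun x => by rw [hσ]) := by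
  have key : ∀ S : Finset F, Equiv.Perm.sign (Equiv.Perm.ofSubtype
      (σ.subtypePerm (p := fun x => s x ∈ S) fun x => by rw [hσ])) = ∏ f ∈ S, Equiv.Perm.sign
      (σ.subtypePerm (p := fun x => s x = f) fun x => by rw [hσ]) := by
    intro S
    induction S using Finset.induction_on with
    | empty =>
      rw [Finset.prod_empty]
      convert Equiv.Perm.sign_one
      ext x
      rw [Equiv.Perm.ofSubtype_apply_of_not_mem _ (by simp)]
      rfl
    | insert a S ha ih =>
      rw [Finset.prod_insert ha, ← ih, ← Equiv.Perm.sign_ofSubtype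
        (σ.subtypePerm (p := fun x => s x = a) fun x => by rw [hσ]), ← Equiv.Perm.sign_mul]
      congr 1
      ext x
      rw [Equiv.Perm.mul_apply]
      by_cases h1 : s x ∈ S
      · have h2 : s x ≠ a := fun h => ha (h ▸ h1)
        rw [Equiv.Perm.ofSubtype_apply_of_mem _ (by simp [h1]),
          Equiv.Perm.ofSubtype_apply_of_mem (p := fun x => s x ∈ S) _ h1,
          Equiv.Perm.ofSubtype_apply_of_not_mem]
        · rfl
        · simpa [hσ] using h2
      · rw [Equiv.Perm.ofSubtype_apply_of_not_mem (p := fun x => s x ∈ S) _ h1]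
        by_cases h2 : s x = a
        · rw [Equiv.Perm.ofSubtype_apply_of_mem _ (by simp [h2]),
            Equiv.Perm.ofSubtype_apply_of_mem (p := fun x => s x = a) _ h2]
          rfl
        · rw [Equiv.Perm.ofSubtype_apply_of_not_mem _ (by simp [h2, h1]),
            Equiv.Perm.ofSubtype_apply_of_not_mem (p := fun x => s x = a) _ h2]
  rw [← key Finset.univ]
  congr 1
  ext x
  rw [Equiv.Perm.ofSubtype_apply_of_mem _ (by simp)]
  rfl

namespace BratteliDiagram

variable (B : BratteliDiagram)

def segOf (n L : ℕ) (x : B.Path) : B.Seg n L :=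
  ⟨fun i => x.1 (n + i), fun i _ => x.2 (n + i)⟩

abbrev SegTo (n L : ℕ) (w : B.V (n + L + 1)) : Type :=
  {f : B.Seg n L // B.rng (n + L) (f.1 ⟨L, by omega⟩) = w}

abbrev SegTo.start {B : BratteliDiagram} {n L : ℕ} {w : B.V (n + L + 1)} (f : B.SegTo n L w) :
    B.V n := B.src n (f.1.1 ⟨0, by omega⟩)

theorem exists_seg_path (n L : ℕ) (t : B.Path)
    (f : B.SegTo n L (B.src (n + L + 1) (t.1 (n + L + 1)))) :
    ∃ t' : B.Path, B.segOf n L t' = f.1 ∧ ∀ j, n + L + 1 ≤ j → t'.1 j = t.1 j := by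
  obtain ⟨x, hx⟩ := B.exists_path_through n f.start
  let F : ∀ i : ℕ, B.E (n + i) := fun i =>
    if h : i < L + 1 then f.1.1 ⟨i, h⟩ else t.1 (n + i)
  have F1 : ∀ i (h : i < L + 1), F i = f.1.1 ⟨i, h⟩ := fun i h => dif_pos h
  have F2 : ∀ i, L + 1 ≤ i → F i = t.1 (n + i) := fun i h => dif_neg (by omega)
  obtain ⟨y, -, hy⟩ := B.exists_glue n x F (fun i => by
    rcases lt_trichotomy i L with h | h | h
    · rw [F1 i (by omega), F1 (i + 1) (by omega)]
      exact f.1.2 i h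
    · subst h
      rw [F1 i (by omega), F2 (i + 1) (by omega)]
      exact f.2
    · rw [F2 i (by omega), F2 (i + 1) (by omega)]
      exact t.2 (n + i)) (by rw [F1 0 (by omega)]; exact hx)
  refine ⟨y, Subtype.ext (funext fun i => ?_), fun j hj => ?_⟩
  · exact (hy i).trans (F1 i i.2)
  · obtain ⟨i, rfl⟩ := Nat.exists_eq_add_of_le (show n ≤ j by omega)
    exact (hy i).trans (F2 i (by omega))

def segPath (n L : ℕ) (t : B.Path)
    (f : B.SegTo n L (B.src (n + L + 1) (t.1 (n + L + 1)))) : B.Path :=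
  (B.exists_seg_path n L t f).choose

theorem segPath_seg (n L : ℕ) (t : B.Path)
    (f : B.SegTo n L (B.src (n + L + 1) (t.1 (n + L + 1)))) :
    B.segOf n L (B.segPath n L t f) = f.1 := (B.exists_seg_path n L t f).choose_spec.1

theorem segPath_ge (n L : ℕ) (t : B.Path)
    (f : B.SegTo n L (B.src (n + L + 1) (t.1 (n + L + 1)))) (j : ℕ) (hj : n + L + 1 ≤ j) :
    (B.segPath n L t f).1 j = t.1 j := (B.exists_seg_path n L t f).choose_spec.2 j hj

theorem segPath_start (n L : ℕ) (t : B.Path)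
    (f : B.SegTo n L (B.src (n + L + 1) (t.1 (n + L + 1)))) :
    B.src n ((B.segPath n L t f).1 n) = f.start := by
  have := congrArg (fun g : B.Seg n L => B.src n (g.1 ⟨0, by omega⟩)) (B.segPath_seg n L t f)
  exact this

theorem segOf_eq_iff (n L : ℕ) (x y : B.Path) :
    B.segOf n L x = B.segOf n L y ↔ ∀ j, n ≤ j → j < n + L + 1 → x.1 j = y.1 j := by
  constructor
  · intro h j hj hj'
    obtain ⟨i, rfl⟩ := Nat.exists_eq_add_of_le hj
    exact congrFun (congrArg Subtype.val h) (⟨i, by omega⟩ : Fin (L + 1))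
  · intro h
    exact Subtype.ext (funext fun i => h _ (by omega) (by omega))

/-- The segment map on `PT`. -/
def segMap (A : Set B.Path) (n L : ℕ) (t : B.Path) (x : B.PT A (n + L + 1) t) :
    B.SegTo n L (B.src (n + L + 1) (t.1 (n + L + 1))) :=
  ⟨B.segOf n L x.1, by
    rw [← x.2.2 (n + L + 1) le_rfl]
    exact x.1.2 (n + L)⟩

theorem segMap_eq_iff (A : Set B.Path) (n L : ℕ) (t : B.Path) (x : B.PT A (n + L + 1) t) (f) :
    B.segMap A n L t x = f ↔ B.PSet A n (B.segPath n L t f) x.1 := by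
  rw [← Subtype.coe_inj, ← B.segPath_seg n L t f]
  change B.segOf n L x.1 = _ ↔ _
  rw [segOf_eq_iff]
  constructor
  · intro h
    refine ⟨x.2.1, fun j hj => ?_⟩
    rcases lt_or_ge j (n + L + 1) with h' | h'
    · exact h j hj h'
    · rw [B.segPath_ge n L t f j h', x.2.2 j h']
  · intro h j hj _
    exact h.2 j hj

def fiberEquiv (A : Set B.Path) (n L : ℕ) (t : B.Path) (f) :
    {x : B.PT A (n + L + 1) t // B.segMap A n L t x = f} ≃ B.PT A n (B.segPath n L t f) where
  toFun x := ⟨x.1.1, (B.segMap_eq_iff A n L t x.1 f).1 x.2⟩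
  invFun y := ⟨⟨y.1, y.2.1, fun j hj => by
    rw [y.2.2 j (by omega), B.segPath_ge n L t f j hj]⟩,
    (B.segMap_eq_iff A n L t _ f).2 y.2⟩
  left_inv _ := rfl
  right_inv _ := rfl

theorem sgn_eq_prod {A : Set B.Path} (n L : ℕ) (t : B.Path) {g : ↥B.fullGroup}
    (hg : g ∈ B.GcircN n A) (hg' : g ∈ B.GcircN (n + L + 1) A)
    [Fintype (B.SegTo n L (B.src (n + L + 1) (t.1 (n + L + 1))))] :
    B.sgn t hg' = ∏ f : B.SegTo n L (B.src (n + L + 1) (t.1 (n + L + 1))),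
      B.sgn (B.segPath n L t f) hg := by
  classical
  let _ := Fintype.ofFinite (B.PT A (n + L + 1) t)
  have hs : ∀ x, B.segMap A n L t (B.restr t hg' x) = B.segMap A n L t x := by
    intro x
    refine Subtype.ext ((B.segOf_eq_iff n L _ _).2 fun j hj _ => ?_)
    exact hg.1.1.1 x.1 j hj
  have := sign_fiber (B.segMap A n L t) (B.restr t hg') hs
  unfold sgn
  refine Eq.trans ?_ (this.trans (Finset.prod_congr rfl fun f _ => ?_))
  · congr
  · let _ := Fintype.ofFinite (B.PT A n (B.segPath n L t f))
    refine Equiv.Perm.sign_eq_sign_of_equiv _ _ (B.fiberEquiv A n L t f) fun x => ?_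
    rfl

theorem card_start (n L : ℕ) (w : B.V (n + L + 1)) (v : B.V n) :
    Nat.card {f : B.SegTo n L w // f.start = v} = B.numPaths n L v w := by
  refine Nat.card_congr ⟨fun f => ⟨f.1.1, f.2, f.1.2⟩, fun f => ⟨⟨f.1, f.2.2⟩, f.2.1⟩,
    fun _ => rfl, fun _ => rfl⟩

theorem sgn_eq_one {A : Set B.Path} (n L : ℕ) (hA : B.IsDet n A)
    (hL : ∀ (v : B.V n) (w : B.V (n + L + 1)), Even (B.numPaths n L v w))
    (t : B.Path) {g : ↥B.fullGroup}
    (hg : g ∈ B.GcircN n A) (hg' : g ∈ B.GcircN (n + L + 1) A) : B.sgn t hg' = 1 := by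
  classical
  let _ := B.fintypeV n
  let _ := Fintype.ofFinite (B.SegTo n L (B.src (n + L + 1) (t.1 (n + L + 1))))
  choose u hu using B.exists_path_through n
  rw [B.sgn_eq_prod n L t hg hg']
  have h1 : ∀ f : B.SegTo n L (B.src (n + L + 1) (t.1 (n + L + 1))),
      B.sgn (B.segPath n L t f) hg = B.sgn (u f.start) hg := fun f =>
    B.sgn_congr hA _ _ (by rw [hu, B.segPath_start]) hg
  rw [Finset.prod_congr rfl fun f _ => h1 f]
  rw [← Finset.prod_fiberwise Finset.univ (fun f => SegTo.start f)]
  refine Finset.prod_eq_one fun v _ => ?_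
  rw [Finset.prod_congr rfl (g := fun _ => B.sgn (u v) hg) fun f hf => by
    rw [(Finset.mem_filter.1 hf).2], Finset.prod_const]
  have hc := B.card_start n L (B.src (n + L + 1) (t.1 (n + L + 1))) v
  rw [Nat.card_eq_fintype_card, Fintype.card_subtype] at hc
  rw [hc]
  obtain ⟨r, hr⟩ := hL v (B.src (n + L + 1) (t.1 (n + L + 1)))
  rw [hr, pow_add, ← mul_pow, Int.units_mul_self, one_pow]

theorem card_grow {A : Set B.Path} (n L N : ℕ)
    (hL : ∀ (v : B.V n) (w : B.V (n + L + 1)), 2 ≤ B.numPaths n L v w)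
    (hN : ∀ t, N ≤ Nat.card (B.PT A n t)) (t : B.Path) :
    2 * N ≤ Nat.card (B.PT A (n + L + 1) t) := by
  classical
  let w := B.src (n + L + 1) (t.1 (n + L + 1))
  let _ := Fintype.ofFinite (B.SegTo n L w)
  rw [← Nat.card_congr (Equiv.sigmaFiberEquiv (B.segMap A n L t)), Nat.card_sigma]
  have h2 : 2 ≤ Nat.card (B.SegTo n L w) := by
    obtain ⟨v⟩ := B.nonemptyV n
    refine (hL v w).trans ?_
    rw [← B.card_start]
    exact Nat.card_le_card_of_injective _ Subtype.val_injective
  calc 2 * N ≤ Nat.card (B.SegTo n L w) * N := by gcongr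
    _ = ∑ f : B.SegTo n L w, N := by simp [Nat.card_eq_fintype_card]
    _ ≤ _ := by
      refine Finset.sum_le_sum fun f _ => ?_
      rw [Nat.card_congr (B.fiberEquiv A n L t f)]
      exact hN _

theorem exists_large (heven : B.IsEven) {A : Set B.Path} (hA : ∃ m, B.IsDet m A)
    (hne : A ≠ Set.univ) (j n : ℕ) :
    ∃ m, n ≤ m ∧ B.IsDet m A ∧ ∀ t, 2 ^ j ≤ Nat.card (B.PT A m t) := by
  obtain ⟨x, hx⟩ := (Set.ne_univ_iff_exists_notMem A).1 hne
  induction j with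
  | zero =>
    obtain ⟨k, hk⟩ := hA
    obtain ⟨p, hnp, hkp⟩ : ∃ p, n ≤ p ∧ k ≤ p := ⟨max n k, le_max_left _ _, le_max_right _ _⟩
    have hA1 : B.IsDet p A := hk.mono B hkp
    obtain ⟨L, hL⟩ := heven p
    refine ⟨p + L + 1, by omega, hk.mono B (by omega), fun t => ?_⟩
    have h0 := (hL (B.src p (x.1 p)) (B.src (p + L + 1) (t.1 (p + L + 1)))).1
    rw [← B.card_start, Nat.card_pos_iff] at h0
    obtain ⟨⟨f, hf⟩⟩ := h0.1
    have hs : B.src p (x.1 p) = B.src p ((B.segPath p L t f).1 p) := by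
      rw [B.segPath_start, hf]
    let z : B.PT A p (B.segPath p L t f) := ⟨B.splice p x (B.segPath p L t f) hs,
      fun hh => hx ((hA1 _ _ fun _ hj => B.splice_lt _ hj).1 hh), fun _ hj => B.splice_ge _ hj⟩
    have : Nonempty (B.PT A (p + L + 1) t) := ⟨((B.fiberEquiv A p L t f).symm z).1⟩
    rw [pow_zero]
    exact Nat.card_pos
  | succ j ih =>
    obtain ⟨m, hm, hdet, hc⟩ := ih
    obtain ⟨L, hL⟩ := heven m
    refine ⟨m + L + 1, by omega, hdet.mono B (by omega), fun t => ?_⟩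
    rw [pow_succ, mul_comm]
    refine B.card_grow m L _ (fun v w => ?_) hc t
    obtain ⟨h1, r, hr⟩ := hL v w
    omega

end BratteliDiagram

theorem alternating_le_ker {P Q : Type*} [Finite P] [DecidableEq P] [Fintype P] [Group Q]
    [Finite Q] (h5 : 5 ≤ Nat.card P)
    (hQ : Nat.card Q < Nat.card P) (f : Equiv.Perm P →* Q) : alternatingGroup P ≤ f.ker := by
  refine Equiv.Perm.alternatingGroup_le_of_normal h5 ?_
  rw [Subgroup.nontrivial_iff_ne_bot, Ne, MonoidHom.ker_eq_bot_iff]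
  intro hinj
  have h1 := Nat.card_le_card_of_injective f hinj
  rw [Nat.card_perm] at h1
  have := Nat.self_le_factorial (Nat.card P)
  omega

namespace BratteliDiagram

variable (B : BratteliDiagram)

theorem Gcirc_le_of_finiteIndex (heven : B.IsEven) {A : Set B.Path} (hA : ∃ m, B.IsDet m A)
    (hne : A ≠ Set.univ) (S : Subgroup ↥B.fullGroup)
    (hS : (S.subgroupOf (B.Gcirc A)).FiniteIndex) : B.Gcirc A ≤ S := by
  classical
  intro g hg
  let N := (S.subgroupOf (B.Gcirc A)).normalCore
  have hNS : N ≤ S.subgroupOf (B.Gcirc A) := Subgroup.normalCore_le _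
  suffices h : (⟨g, hg⟩ : B.Gcirc A) ∈ N from hNS h
  have : N.FiniteIndex := inferInstance
  have : Finite (B.Gcirc A ⧸ N) := inferInstance
  obtain ⟨n1, hn1⟩ := B.mem_levelIn_exists g
  obtain ⟨n, hn, hdet, hlarge⟩ :=
    B.exists_large heven hA hne (Nat.card (B.Gcirc A ⧸ N) + 3) n1
  obtain ⟨L, hL⟩ := heven n
  have hgn : g ∈ B.GcircN n A := ⟨B.level_mono hn hn1, hg⟩
  have hgm : g ∈ B.GcircN (n + L + 1) A := B.GcircN_mono A (by omega) hgn
  have hdm : B.IsDet (n + L + 1) A := hdet.mono B (by omega)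
  choose t ht using B.exists_path_through (n + L + 1)
  have hcard : ∀ w, 5 ≤ Nat.card (B.PT A (n + L + 1) (t w)) ∧
      Nat.card (B.Gcirc A ⧸ N) < Nat.card (B.PT A (n + L + 1) (t w)) := by
    intro w
    have h1 := B.card_grow n L _ (fun v w => by
      obtain ⟨h1, r, hr⟩ := hL v w
      omega) hlarge (t w)
    have h2 : Nat.card (B.Gcirc A ⧸ N) < 2 ^ (Nat.card (B.Gcirc A ⧸ N)) := Nat.lt_two_pow_self
    rw [pow_add] at h1
    omega
  let _ : ∀ w, Fintype (B.PT A (n + L + 1) (t w)) := fun w => Fintype.ofFinite _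
  have key : Subgroup.pi Set.univ (fun w => alternatingGroup (B.PT A (n + L + 1) (t w))) ≤
      N.comap (B.theta hdm t ht) := by
    rw [Subgroup.pi_le_iff]
    intro w
    rw [Subgroup.map_le_iff_le_comap]
    have := alternating_le_ker (hcard w).1 (hcard w).2
      (((QuotientGroup.mk' N).comp (B.theta hdm t ht)).comp
        (MonoidHom.mulSingle (fun w => Equiv.Perm (B.PT A (n + L + 1) (t w))) w))
    intro σ hσ
    have h3 := this hσ
    rw [MonoidHom.mem_ker] at h3
    exact (QuotientGroup.eq_one_iff (N := N) (B.theta hdm t ht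
      (MonoidHom.mulSingle (fun w => Equiv.Perm (B.PT A (n + L + 1) (t w))) w σ))).1 h3
  have hmem : (fun w => B.restr (t w) hgm) ∈
      Subgroup.pi Set.univ (fun w => alternatingGroup (B.PT A (n + L + 1) (t w))) := by
    intro w _
    change B.restr (t w) hgm ∈ alternatingGroup _
    rw [Equiv.Perm.mem_alternatingGroup]
    have := B.sgn_eq_one n L hdet (fun v w => (hL v w).2) (t w) hgn hgm
    unfold sgn at this
    convert this
  have h4 := key hmem
  have h5 : B.theta hdm t ht (fun w => B.restr (t w) hgm) = ⟨g, hg⟩ :=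
    Subtype.ext (B.theta_restr hdm t ht hgm)
  rw [Subgroup.mem_comap, h5] at h4
  exact h4

theorem exists_moves (heven : B.IsEven) {A : Set B.Path} (hA : ∃ m, B.IsDet m A)
    (hne : A ≠ Set.univ) (x : B.Path) (hx : x ∉ A) : ∃ g ∈ B.Gcirc A, g.1 x ≠ x := by
  classical
  obtain ⟨m, -, hdet, hlarge⟩ := B.exists_large heven hA hne 1 0
  choose t ht using B.exists_path_through m
  let w := B.src m (x.1 m)
  have : Nontrivial (B.PT A m (t w)) := by
    rw [← Finite.one_lt_card_iff_nontrivial]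
    have := hlarge (t w)
    omega
  obtain ⟨z, hz⟩ := exists_ne (B.base hdet t ht x hx w rfl)
  let σ : ∀ w, Equiv.Perm (B.PT A m (t w)) :=
    Pi.mulSingle w (Equiv.swap (B.base hdet t ht x hx w rfl) z)
  refine ⟨_, (B.theta hdet t ht σ).2, fun h => hz ?_⟩
  have h' : B.thetaFun hdet t ht σ x = x := h
  have hb := B.base_thetaFun hdet t ht σ hx w rfl (by rw [h']; exact hx) (by rw [h'])
  have hσ : σ w = Equiv.swap (B.base hdet t ht x hx w rfl) z := Pi.mulSingle_eq_same _ _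
  rw [hσ, Equiv.swap_apply_left] at hb
  rw [← hb]
  congr 1

theorem Gcirc_le_of_relIndex_le (heven : B.IsEven) {A : Set B.Path} (hA : ∃ m, B.IsDet m A)
    (hne : A ≠ Set.univ) (S : Subgroup ↥B.fullGroup)
    (r : ℕ) (hS : ∀ n, S.relIndex (B.GcircN n A) ≤ r) : B.Gcirc A ≤ S := by
  classical
  refine B.Gcirc_le_of_finiteIndex heven hA hne S ?_
  by_contra hfin
  have hinf : Infinite (B.Gcirc A ⧸ S.subgroupOf (B.Gcirc A)) := by
    by_contra h
    rw [not_infinite_iff_finite] at h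
    exact hfin Subgroup.finiteIndex_of_finite_quotient
  obtain ⟨s, hs⟩ := Infinite.exists_subset_card_eq (B.Gcirc A ⧸ S.subgroupOf (B.Gcirc A)) (r + 1)
  choose n hn using fun q : B.Gcirc A ⧸ S.subgroupOf (B.Gcirc A) =>
    B.mem_levelIn_exists q.out.1
  let M := s.sup n
  have hM : ∀ q ∈ s, q.out.1 ∈ B.GcircN M A := fun q hq =>
    ⟨B.level_mono (Finset.le_sup hq) (hn q), q.out.2⟩
  let F : s → (B.GcircN M A ⧸ S.subgroupOf (B.GcircN M A)) := fun q =>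
    QuotientGroup.mk ⟨q.1.out.1, hM q.1 q.2⟩
  have hF : Function.Injective F := by
    intro a b hab
    rw [QuotientGroup.eq] at hab
    apply Subtype.ext
    rw [← a.1.out_eq', ← b.1.out_eq']
    exact QuotientGroup.eq.2 hab
  have := Nat.card_le_card_of_injective F hF
  have h2 := hS M
  rw [Subgroup.relIndex, Subgroup.index] at h2
  simp [hs] at this
  omega

end BratteliDiagram

theorem tendsto_avg {G : Type*} [Group G] (K : ℕ → Subgroup G) (hK : Monotone K)
    [∀ n, Fintype (K n)] (Γ : Subgroup G) (hKΓ : ∀ n, K n ≤ Γ)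
    (hΓ : ∀ (S : Subgroup G) (r : ℕ), (∀ n, S.relIndex (K n) ≤ r) → Γ ≤ S)
    {Y : Type*} [MeasurableSpace Y] (ν : Measure Y) [IsFiniteMeasure ν] (St : Y → Subgroup G)
    (hSt : ∀ g, MeasurableSet {y | g ∈ St y}) (hm : MeasurableSet {y | Γ ≤ St y}) :
    Tendsto (fun n => ∑ k : K n, ((Nat.card (K n) : ℝ≥0∞)⁻¹ * ν {y | (k : G) ∈ St y})) atTop
      (nhds (ν {y | Γ ≤ St y})) := by
  classical
  have hpos : ∀ n, (Nat.card (K n) : ℝ≥0∞) ≠ 0 := fun n => by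
    exact_mod_cast Nat.card_pos.ne'
  have hfun : ∀ n y, ∑ k : K n, (Nat.card (K n) : ℝ≥0∞)⁻¹ *
      ({y | (k : G) ∈ St y}.indicator 1 y : ℝ≥0∞) = (((St y).relIndex (K n) : ℕ) : ℝ≥0∞)⁻¹ := by
    intro n y
    have h1 : ∑ k : K n, ({y | (k : G) ∈ St y}.indicator 1 y : ℝ≥0∞)
        = (Nat.card ((St y).subgroupOf (K n)) : ℝ≥0∞) := by
      rw [Nat.card_eq_fintype_card]
      simp only [Set.indicator_apply, Set.mem_ofPred_eq, Pi.one_apply]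
      rw [Finset.sum_boole]
      congr 1
      exact (Fintype.card_subtype _).symm
    rw [← Finset.mul_sum, h1]
    have h2 := Subgroup.index_mul_card ((St y).subgroupOf (K n))
    have h3 : (((St y).relIndex (K n) : ℕ) : ℝ≥0∞) * (Nat.card ((St y).subgroupOf (K n)) : ℝ≥0∞)
        = (Nat.card (K n) : ℝ≥0∞) := by exact_mod_cast h2
    have h4 : (Nat.card ((St y).subgroupOf (K n)) : ℝ≥0∞) ≠ 0 := by
      exact_mod_cast Nat.card_pos.ne'
    rw [← h3, ENNReal.mul_inv (Or.inr (ENNReal.natCast_ne_top _)) (Or.inr h4), mul_assoc,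
      ENNReal.inv_mul_cancel h4 (ENNReal.natCast_ne_top _), mul_one]
  have hinteg : ∀ n, ∑ k : K n, ((Nat.card (K n) : ℝ≥0∞)⁻¹ * ν {y | (k : G) ∈ St y}) =
      ∫⁻ y, (((St y).relIndex (K n) : ℕ) : ℝ≥0∞)⁻¹ ∂ν := by
    intro n
    simp_rw [← hfun n]
    rw [lintegral_finsetSum]
    · refine Finset.sum_congr rfl fun k _ => ?_
      rw [lintegral_const_mul _ (measurable_one.indicator (hSt k)), lintegral_indicator_one (hSt k)]
    · intro k _
      exact (measurable_one.indicator (hSt k)).const_mul _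
  have hmeas : ∀ n, Measurable fun y => (((St y).relIndex (K n) : ℕ) : ℝ≥0∞)⁻¹ := by
    intro n
    simp_rw [← hfun n]
    exact Finset.measurable_sum _ fun k _ => (measurable_one.indicator (hSt k)).const_mul _
  have hne : ∀ (S : Subgroup G) n, S.relIndex (K n) ≠ 0 := fun S n => Subgroup.index_ne_zero_of_finite
  simp_rw [hinteg]
  rw [← lintegral_indicator_one hm]
  refine tendsto_lintegral_of_dominated_convergence (fun _ => 1) hmeas
    (fun n => Eventually.of_forall fun y => ?_) (by simp) (Eventually.of_forall fun y => ?_)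
  · rw [ENNReal.inv_le_one]
    exact_mod_cast Nat.one_le_iff_ne_zero.2 (hne _ _)
  · by_cases hy : Γ ≤ St y
    · rw [Set.indicator_of_mem (show y ∈ {y | Γ ≤ St y} from hy)]
      have : ∀ n, (St y).relIndex (K n) = 1 := fun n =>
        Subgroup.relIndex_eq_one.2 ((hKΓ n).trans hy)
      simp [this]
    · rw [Set.indicator_of_notMem (show y ∉ {y | Γ ≤ St y} from hy)]
      have hmono : Monotone fun n => (St y).relIndex (K n) := fun a b hab =>
        Subgroup.relIndex_le_of_le_right (hK hab) (hne _ _)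
      have hub : Tendsto (fun n => (St y).relIndex (K n)) atTop atTop := by
        refine tendsto_atTop_atTop_of_monotone hmono fun r => ?_
        by_contra! hcon
        exact hy (hΓ _ r fun n => (hcon n).le)
      exact ENNReal.tendsto_inv_nat_nhds_zero.comp hub

theorem conjSub_eq_iff {G : Type*} [Group G] (g : G) (H : Subgroup G) :
    conjSub g H = H ↔ g ∈ Subgroup.normalizer (H : Set G) := by
  rw [Subgroup.mem_normalizer_iff'', conjSub, SetLike.ext_iff]
  have : ∀ x, x ∈ Subgroup.map (MulAut.conj g).toMonoidHom H ↔ g⁻¹ * x * g ∈ H := by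
    intro x
    constructor
    · rintro ⟨h, hh, rfl⟩
      simpa [mul_assoc] using hh
    · intro h
      exact ⟨_, h, by simp [mul_assoc]⟩
  exact forall_congr' fun x => by rw [this]; exact iff_comm

theorem measurableSet_normalizer {G : Type*} [Group G] [Countable G] (g : G) :
    MeasurableSet {H : Subgroup G | g ∈ Subgroup.normalizer (H : Set G)} := by
  have hx : ∀ x : G, MeasurableSet {H : Subgroup G | x ∈ H} := fun x =>
    ⟨{s : Set G | x ∈ s}, measurableSet_mem x, rfl⟩
  simp only [Subgroup.mem_normalizer_iff'']
  rw [Set.ofPred_forall]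
  refine MeasurableSet.iInter fun x => ?_
  exact MeasurableSet.iff (hx x) (hx _)

theorem BratteliDiagram.measurableSet_fix (B : BratteliDiagram) (g : B.fullGroup) :
    MeasurableSet {x : B.Path | g • x = x} := by
  obtain ⟨n, hn⟩ := B.mem_levelIn_exists g
  have h1 : B.IsLevel n g.1 := hn.1
  have hdet : B.IsDet n {x : B.Path | g • x = x} := by
    intro x y hxy
    have key : ∀ x y : B.Path, (∀ i : ℕ, i < n → x.1 i = y.1 i) → g • x = x → g • y = y := by
      intro x y hxy hx
      have hx' : g.1 x = x := hx
      show g.1 y = y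
      apply Subtype.ext
      funext i
      rcases lt_or_ge i n with h | h
      · rw [← h1.2 x y hxy i h, hx', hxy i h]
      · exact h1.1 y i h
    exact ⟨key x y hxy, key y x fun i hi => (hxy i hi).symm⟩
  exact (hdet.isOpen B).measurableSet

theorem BratteliDiagram.measurableSet_fixPow (B : BratteliDiagram) {ι : Type*} [Finite ι]
    (g : B.fullGroup) :
    MeasurableSet {y : ι → B.Path | g • y = y} := by
  have : {y : ι → B.Path | g • y = y} = ⋂ p, (fun y => y p) ⁻¹' {x : B.Path | g • x = x} := by
    ext y
    simp [funext_iff]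
  rw [this]
  exact MeasurableSet.iInter fun p => measurable_pi_apply p (B.measurableSet_fix g)

theorem BratteliDiagram.Gcirc_le_stab_iff (B : BratteliDiagram) (heven : B.IsEven)
    {A : Set B.Path} (hA : IsClopen A) (hne : A ≠ Set.univ) {ι : Type*} (y : ι → B.Path) :
    B.Gcirc A ≤ MulAction.stabilizer ↥B.fullGroup y ↔ ∀ p, y p ∈ A := by
  constructor
  · intro h p
    by_contra hp
    obtain ⟨g, hg, hgx⟩ := B.exists_moves heven (B.exists_isDet hA) hne (y p) hp
    have := MulAction.mem_stabilizer_iff.1 (h hg)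
    exact hgx (congrFun this p)
  · intro h g hg
    rw [MulAction.mem_stabilizer_iff]
    funext p
    exact (B.mem_Gcirc).1 hg _ (h p)

theorem tendsto_tsum_mul {ι : Type*} [Countable ι] (c : ι → ℝ≥0∞) (hc : ∑' i, c i ≠ ⊤)
    (f : ℕ → ι → ℝ≥0∞) (g : ι → ℝ≥0∞) (hf : ∀ n i, f n i ≤ 1)
    (hfg : ∀ i, Tendsto (fun n => f n i) atTop (nhds (g i))) :
    Tendsto (fun n => ∑' i, c i * f n i) atTop (nhds (∑' i, c i * g i)) := by
  letI : MeasurableSpace ι := ⊤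
  simp only [← lintegral_count]
  refine tendsto_lintegral_of_dominated_convergence c (fun n => measurable_from_top)
    (fun n => Eventually.of_forall fun i => ?_) ?_ (Eventually.of_forall fun i => ?_)
  · exact (mul_le_mul_right (hf n i) (c i)).trans (mul_one _).le
  · rwa [lintegral_count]
  · exact ENNReal.Tendsto.const_mul (hfg i) (Or.inr (ENNReal.ne_top_of_tsum_ne_top hc i))

/-- if an atomless ergodic IRS `φ` has fixed-point function decomposing as
`c_∞·1_{g=e} + Σ_α c_α·μ_α(Fix_{X^{|α|}}(g))`, then for every proper clopen `A`,
`φ(F(A)) = Σ_α c_α·μ_α(A^{|α|})`. -/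
theorem phi_FF_eq_sum (B : BratteliDiagram)
    (hsimple : B.IsSimple) (heven : B.IsEven)
    (k : ℕ) (hk : 1 ≤ k) (μ : Fin k → Measure B.Path)
    (hprob : ∀ i, IsProbabilityMeasure (μ i))
    (hinv : ∀ i, MeasInv ↥B.fullGroup (μ i))
    (herg : ∀ i, MeasErg ↥B.fullGroup (μ i))
    (hdistinct : Function.Injective μ)
    (hcomplete : ∀ ν : Measure B.Path, IsProbabilityMeasure ν →
      MeasInv ↥B.fullGroup ν → MeasErg ↥B.fullGroup ν → ∃ i, ν = μ i)
    (φ : Measure (Subgroup ↥B.fullGroup)) (hφ : IsErgodicIRS ↥B.fullGroup φ)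
    (hatomless : ∀ H : Subgroup ↥B.fullGroup, φ {H} = 0)
    (c : (Fin k → ℕ) → ℝ≥0∞) (cinf : ℝ≥0∞)
    (hsum : cinf + ∑' α : Fin k → ℕ, c α = 1)
    (hchar : ∀ g : ↥B.fullGroup,
      φ {H : Subgroup ↥B.fullGroup | conjSub g H = H}
        = ({1} : Set ↥B.fullGroup).indicator (fun _ => cinf) g
          + ∑' α : Fin k → ℕ,
              c α * B.prodMeasure μ α {y : (Σ i : Fin k, Fin (α i)) → B.Path | g • y = y})
    (A : Set B.Path) (hA : IsClopen A) (hAne : A ≠ Set.univ) :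
    φ (B.FF A)
      = ∑' α : Fin k → ℕ,
          c α * B.prodMeasure μ α {y : (Σ i : Fin k, Fin (α i)) → B.Path | ∀ p, y p ∈ A} := by
  classical
  have hdet := B.exists_isDet hA
  letI : ∀ n, Fintype (B.GcircN n A) := fun n => Fintype.ofFinite _
  have hprobφ : IsProbabilityMeasure φ := hφ.1.1
  have hK : Monotone fun n => B.GcircN n A := B.GcircN_mono A
  have hKΓ : ∀ n, B.GcircN n A ≤ B.Gcirc A := fun n => inf_le_right
  have hΓ : ∀ (S : Subgroup ↥B.fullGroup) (r : ℕ),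
      (∀ n, S.relIndex (B.GcircN n A) ≤ r) → B.Gcirc A ≤ S :=
    fun S r hS => B.Gcirc_le_of_relIndex_le heven hdet hAne S r hS
  have hcard : ∀ n, (Nat.card (B.GcircN n A) : ℝ≥0∞) ≠ 0 := fun n => by
    exact_mod_cast Nat.card_pos.ne'
  have hcinf : cinf ≠ ⊤ := by
    intro h
    rw [h, top_add] at hsum
    exact ENNReal.top_ne_one hsum
  have hcsum : ∑' α : Fin k → ℕ, c α ≠ ⊤ := by
    intro h
    rw [h, add_top] at hsum
    exact ENNReal.top_ne_one hsum
  -- left-hand side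
  have hFF : {H : Subgroup ↥B.fullGroup | B.Gcirc A ≤ Subgroup.normalizer (H : Set ↥B.fullGroup)}
      = B.FF A := by
    ext H
    exact forall_congr' fun g => forall_congr' fun _ => (conjSub_eq_iff g H).symm
  have hm1 : MeasurableSet
      {H : Subgroup ↥B.fullGroup | B.Gcirc A ≤ Subgroup.normalizer (H : Set ↥B.fullGroup)} := by
    have : {H : Subgroup ↥B.fullGroup |
        B.Gcirc A ≤ Subgroup.normalizer (H : Set ↥B.fullGroup)} =
        ⋂ g : B.Gcirc A, {H : Subgroup ↥B.fullGroup | (g : ↥B.fullGroup) ∈ Subgroup.normalizer (H : Set ↥B.fullGroup)} := by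
      ext H
      simp only [Set.mem_iInter]
      exact ⟨fun h g => h g.2, fun h g hg => h ⟨g, hg⟩⟩
    rw [this]
    exact MeasurableSet.iInter fun g => measurableSet_normalizer _
  have hL := tendsto_avg (fun n => B.GcircN n A) hK (B.Gcirc A) hKΓ hΓ φ
    (fun H => Subgroup.normalizer (H : Set ↥B.fullGroup)) measurableSet_normalizer hm1
  rw [hFF] at hL
  -- the regular part
  have hbot : ¬ B.Gcirc A ≤ (⊥ : Subgroup ↥B.fullGroup) := by
    intro h
    obtain ⟨x, hx⟩ := (Set.ne_univ_iff_exists_notMem A).1 hAne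
    obtain ⟨g, hg, hgx⟩ := B.exists_moves heven hdet hAne x hx
    have := Subgroup.mem_bot.1 (h hg)
    subst this
    exact hgx rfl
  have hR := tendsto_avg (fun n => B.GcircN n A) hK (B.Gcirc A) hKΓ hΓ (Measure.dirac ())
    (fun _ => (⊥ : Subgroup ↥B.fullGroup)) (fun g => MeasurableSet.const _)
    (MeasurableSet.const _)
  have hR0 : {y : Unit | B.Gcirc A ≤ (⊥ : Subgroup ↥B.fullGroup)} = ∅ := by
    ext y
    exact ⟨fun h => hbot h, fun h => h.elim⟩
  rw [hR0, measure_empty] at hR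
  -- the parts indexed by `α`
  have hpm : ∀ α : Fin k → ℕ, IsProbabilityMeasure (B.prodMeasure μ α) := fun α => by
    unfold BratteliDiagram.prodMeasure
    infer_instance
  have hset : ∀ α : Fin k → ℕ, {y : (Σ i : Fin k, Fin (α i)) → B.Path |
      B.Gcirc A ≤ MulAction.stabilizer ↥B.fullGroup y} = {y | ∀ p, y p ∈ A} := fun α => by
    ext y
    exact B.Gcirc_le_stab_iff heven hA hAne y
  have hSα : ∀ α : Fin k → ℕ, MeasurableSet {y : (Σ i : Fin k, Fin (α i)) → B.Path |
      ∀ p, y p ∈ A} := fun α => by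
    rw [Set.ofPred_forall]
    exact MeasurableSet.iInter fun p => measurable_pi_apply p hA.isOpen.measurableSet
  have hα := fun α : Fin k → ℕ =>
    tendsto_avg (fun n => B.GcircN n A) hK (B.Gcirc A) hKΓ hΓ (B.prodMeasure μ α)
    (fun y => MulAction.stabilizer ↥B.fullGroup y) (fun g => B.measurableSet_fixPow g)
    (by rw [hset]; exact hSα α)
  simp only [hset] at hα
  have hle : ∀ n (α : Fin k → ℕ), ∑ g : B.GcircN n A, ((Nat.card (B.GcircN n A) : ℝ≥0∞)⁻¹ *
      B.prodMeasure μ α {y | (g : ↥B.fullGroup) ∈ MulAction.stabilizer ↥B.fullGroup y}) ≤ 1 := by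
    intro n α
    calc _ ≤ ∑ g : B.GcircN n A, (Nat.card (B.GcircN n A) : ℝ≥0∞)⁻¹ :=
          Finset.sum_le_sum fun g _ => (mul_le_mul_right prob_le_one _).trans (mul_one _).le
      _ = 1 := by
          rw [Finset.sum_const, Finset.card_univ, ← Nat.card_eq_fintype_card, nsmul_eq_mul]
          exact ENNReal.mul_inv_cancel (hcard n) (ENNReal.natCast_ne_top _)
  have hT := tendsto_tsum_mul c hcsum _ _ hle hα
  have hR' := ENNReal.Tendsto.const_mul (a := cinf) hR (Or.inr hcinf)
  have hsumT := hR'.add hT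
  rw [mul_zero, zero_add] at hsumT
  refine tendsto_nhds_unique hL (hsumT.congr fun n => ?_)
  have hterm : ∀ g : B.GcircN n A,
      φ {H : Subgroup ↥B.fullGroup | (g : ↥B.fullGroup) ∈
        Subgroup.normalizer (H : Set ↥B.fullGroup)}
      = cinf * Measure.dirac () {y : Unit | (g : ↥B.fullGroup) ∈ (⊥ : Subgroup ↥B.fullGroup)}
        + ∑' α : Fin k → ℕ, c α * B.prodMeasure μ α {y : (Σ i : Fin k, Fin (α i)) → B.Path |
          (g : ↥B.fullGroup) ∈ MulAction.stabilizer ↥B.fullGroup y} := by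
    intro g
    have h1 := hchar (g : ↥B.fullGroup)
    simp only [conjSub_eq_iff] at h1
    rw [h1]
    congr 1
    by_cases hg : (g : ↥B.fullGroup) = 1
    · simp [hg]
    · simp [hg]
  simp only [hterm, mul_add, Finset.sum_add_distrib, Finset.mul_sum]
  congr 1
  · exact Finset.sum_congr rfl fun g _ => mul_left_comm _ _ _
  · rw [Summable.tsum_finsetSum (fun _ _ => ENNReal.summable)]
    refine Finset.sum_congr rfl fun g _ => ?_
    rw [← ENNReal.tsum_mul_left]
    exact tsum_congr fun α => mul_left_comm _ _ _
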